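/- Bounded decomposition for a single synchronizing transition: let c ∈ C and suppose the restriction of ∼_c to V_{{c}} has exactly k equivalence classes, with k finite. Then for all vertices u, v of G, Reach_{Σ^l ∪ {c}}(u,v) holds in G if and only if there exists m with 0 ≤ m ≤ k such that for every component i there are vertices y_0^i, x_1^i, y_1^i, …, x_m^i, y_m^i ∈ V_i with: Reach_{Σ_i^l}(u_i, y_0^i) in G_i; for each 1 ≤ j ≤ m, E^i_{c_i}(y_{j-1}^i, x_j^i) if c_i ≠ ε and x_j^i = y_{j-1}^i if c_i = ε, and Reach_{Σ_i^l}(x_j^i, y_j^i) in G_i; and y_m^i = v_i. -/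

import Mathlib

/- Synchronized products of labeled transition systems.
   Component `i` has vertex type `V i`, local labels `Locl i`, synchronizing
   labels `Syncl i` (distinct types across components model disjointness),
   and edge relations `Eloc i a`, `Esync i a`.  A synchronization constraint
   is a set of tuples `c : ∀ i, Option (Syncl i)` where `none` plays the role
   of ε. -/

namespace SyncProd

variable {n : ℕ} {V : Fin n → Type*} {Locl : Fin n → Type*} {Syncl : Fin n → Type*}

/-- Effect of an optional synchronizing label in one component
    (`none` = ε means the component does not move). -/
def OptStep {α β : Type*} (E : β → α → α → Prop) : Option β → α → α → Prop
  | some a => E a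
  | none => Eq

/-- A local `a`-labeled edge of the product, acting in component `i`:
    `E_a^G(u,v)` iff `E_a^i(u_i,v_i)` and `u_j = v_j` for `j ≠ i`. -/
def LocEdge (Eloc : ∀ i, Locl i → V i → V i → Prop) (i : Fin n) (a : Locl i)
    (u v : ∀ j, V j) : Prop :=
  Eloc i a (u i) (v i) ∧ ∀ j, j ≠ i → u j = v j

/-- A synchronized edge of the product labeled by the constraint tuple `c`:
    componentwise `E_{c_i}^i` where `c_i ≠ ε`, and equality where `c_i = ε`. -/
def SyncEdge (Esync : ∀ i, Syncl i → V i → V i → Prop)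
    (c : ∀ i, Option (Syncl i)) (u v : ∀ j, V j) : Prop :=
  ∀ i, OptStep (Esync i) (c i) (u i) (v i)

/-- One step of the product with a label in `Σ^l ∪ C'`:
    either some local edge, or a synchronized edge with tuple in `C'`. -/
def Step (Eloc : ∀ i, Locl i → V i → V i → Prop)
    (Esync : ∀ i, Syncl i → V i → V i → Prop)
    (C' : Set (∀ i, Option (Syncl i))) (u v : ∀ j, V j) : Prop :=
  (∃ i, ∃ a, LocEdge Eloc i a u v) ∨ ∃ c ∈ C', SyncEdge Esync c u v

/-- `u ∼_{C'} v` : `u` and `v` agree on every component in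
    `X_{C'} = ⋃_{c ∈ C'} {i | c_i ≠ ε}`. -/
def SimC (C' : Set (∀ i, Option (Syncl i))) (u v : ∀ j, V j) : Prop :=
  ∀ i, (∃ c ∈ C', c i ≠ none) → u i = v i

/-- `V_{C'}` : the vertices of the product from which an outgoing `c`-labeled
    synchronized transition exists for every `c ∈ C'`. -/
def VC (Esync : ∀ i, Syncl i → V i → V i → Prop)
    (C' : Set (∀ i, Option (Syncl i))) : Set (∀ j, V j) :=
  {u | ∀ c ∈ C', ∃ w, SyncEdge Esync c u w}

/-- The set of equivalence classes of `∼_{C'}` restricted to `V_{C'}`. -/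
def Classes (Esync : ∀ i, Syncl i → V i → V i → Prop)
    (C' : Set (∀ i, Option (Syncl i))) : Set (Set (∀ j, V j)) :=
  {s | ∃ u ∈ VC Esync C', s = {v | v ∈ VC Esync C' ∧ SimC C' u v}}

/-- Reachability inside component `i` using only its local edges. -/
def ReachLoc (Eloc : ∀ i, Locl i → V i → V i → Prop) (i : Fin n) : V i → V i → Prop :=
  Relation.ReflTransGen (fun p q => ∃ a, Eloc i a p q)

end SyncProd

open SyncProd Relation


section Aux

variable {n : ℕ} {V : Fin n → Type*} {Locl : Fin n → Type*} {Syncl : Fin n → Type*}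

theorem aux_single (Eloc : ∀ i, Locl i → V i → V i → Prop)
    (Esync : ∀ i, Syncl i → V i → V i → Prop) (C' : Set (∀ i, Option (Syncl i)))
    (w : ∀ i, V i) (i : Fin n) (p q : V i) (h : ReachLoc Eloc i p q) :
    ReflTransGen (Step Eloc Esync C') (Function.update w i p) (Function.update w i q) := by
  refine ReflTransGen.lift (Function.update w i) ?_ _ _ h
  rintro a b ⟨l, hl⟩
  refine Or.inl ⟨i, l, ?_, ?_⟩
  · simpa using hl
  · intro j hj
    simp [Function.update_of_ne hj]

theorem aux_local (Eloc : ∀ i, Locl i → V i → V i → Prop)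
    (Esync : ∀ i, Syncl i → V i → V i → Prop) (C' : Set (∀ i, Option (Syncl i)))
    (u v : ∀ i, V i) (h : ∀ i, ReachLoc Eloc i (u i) (v i)) :
    ReflTransGen (Step Eloc Esync C') u v := by
  classical
  have key : ∀ s : Finset (Fin n),
      ReflTransGen (Step Eloc Esync C') u (fun i => if i ∈ s then v i else u i) := by
    intro s
    induction s using Finset.induction_on with
    | empty => simpa using ReflTransGen.refl
    | insert a s ha ih =>
      refine ih.trans ?_
      have := aux_single Eloc Esync C' (fun i => if i ∈ s then v i else u i) a (u a) (v a) (h a)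
      convert this using 1
      · funext j
        by_cases hj : j = a
        · subst hj; simp [ha]
        · simp [Function.update_of_ne hj]
      · funext j
        by_cases hj : j = a
        · subst hj; simp
        · simp [Function.update_of_ne hj, hj]
  simpa using key Finset.univ

/-- A path with `m` synchronized steps. -/
def AuxPath (Eloc : ∀ i, Locl i → V i → V i → Prop)
    (Esync : ∀ i, Syncl i → V i → V i → Prop) (c : ∀ i, Option (Syncl i))
    (u v : ∀ i, V i) (m : ℕ) : Prop :=
  ∃ y x : ℕ → ∀ i, V i, (∀ i, ReachLoc Eloc i (u i) (y 0 i)) ∧ y m = v ∧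
    ∀ j < m, SyncEdge Esync c (y j) (x j) ∧ ∀ i, ReachLoc Eloc i (x j i) (y (j + 1) i)

theorem aux_exists (Eloc : ∀ i, Locl i → V i → V i → Prop)
    (Esync : ∀ i, Syncl i → V i → V i → Prop) (c : ∀ i, Option (Syncl i))
    (u v : ∀ i, V i) (h : ReflTransGen (Step Eloc Esync {c}) u v) :
    ∃ m, AuxPath Eloc Esync c u v m := by
  induction h using ReflTransGen.head_induction_on with
  | refl => exact ⟨0, fun _ => v, fun _ => v, fun _ => ReflTransGen.refl, rfl, by simp⟩
  | head hs hr ih =>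
    rename_i a b
    obtain ⟨m, y, x, h0, hm, hj⟩ := ih
    rcases hs with ⟨i, l, hl, hne⟩ | ⟨c', hc', hs⟩
    · refine ⟨m, y, x, fun j => ?_, hm, hj⟩
      by_cases hji : j = i
      · subst hji
        exact ReflTransGen.head ⟨l, hl⟩ (h0 j)
      · rw [hne j hji]; exact h0 j
    · obtain rfl : c' = c := hc'
      refine ⟨m + 1, fun j => Nat.casesOn j a y, fun j => Nat.casesOn j b x,
        ?_, hm, ?_⟩
      · intro i
        exact ReflTransGen.refl
      intro j hjm
      cases j with
      | zero => exact ⟨hs, h0⟩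
      | succ j => exact hj j (by omega)

theorem aux_shorten (Eloc : ∀ i, Locl i → V i → V i → Prop)
    (Esync : ∀ i, Syncl i → V i → V i → Prop) (c : ∀ i, Option (Syncl i))
    (u v : ∀ i, V i) (hfin : (Classes Esync {c}).Finite) (m : ℕ)
    (hm : (Classes Esync {c}).ncard < m) (h : AuxPath Eloc Esync c u v m) :
    ∃ m' < m, AuxPath Eloc Esync c u v m' := by
  obtain ⟨y, x, h0, hv, hj⟩ := h
  have hVC : ∀ j < m, y j ∈ VC Esync {c} := by
    rintro j hjm c' rfl
    exact ⟨x j, (hj j hjm).1⟩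
  let f : ℕ → Set (∀ i, V i) := fun j => {w | w ∈ VC Esync {c} ∧ SimC {c} (y j) w}
  obtain ⟨a, b, hab, hbm, hf⟩ : ∃ a b, a < b ∧ b < m ∧ f a = f b := by
    by_contra hcon
    push Not at hcon
    have hle := Set.ncard_le_ncard_of_injOn (s := (Finset.range m : Set ℕ)) f
      (t := Classes Esync {c})
      (fun j hjm => ⟨y j, hVC j (by simpa using hjm), rfl⟩)
      (by
        intro p hp q hq hpq
        have hp' : p < m := by simpa using hp
        have hq' : q < m := by simpa using hq
        rcases lt_trichotomy p q with h | h | h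
        · exact absurd hpq (hcon p q h hq')
        · exact h
        · exact absurd hpq.symm (hcon q p h hp')) hfin
    rw [Set.ncard_coe_finset, Finset.card_range] at hle
    omega
  have hsim : SimC {c} (y a) (y b) := by
    have hb : y b ∈ f b := ⟨hVC b hbm, fun _ _ => rfl⟩
    rw [← hf] at hb
    exact hb.2
  have hL : ∀ i, ReachLoc Eloc i (y a i) (y b i) := by
    intro i
    by_cases hci : c i = none
    · have : ∀ d, a + d < m → ReachLoc Eloc i (y a i) (y (a + d) i) := by
        intro d
        induction d with
        | zero => intro _; exact ReflTransGen.refl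
        | succ d ih =>
          intro hd
          have h1 := hj (a + d) (by omega)
          have h2 := h1.1 i
          rw [hci] at h2
          have h3 : y (a + d) i = x (a + d) i := h2
          have h4 := h1.2 i
          rw [← h3] at h4
          exact ReflTransGen.trans (ih (by omega)) h4
      have h5 := this (b - a) (by omega)
      rwa [Nat.add_sub_cancel' hab.le] at h5
    · rw [hsim i ⟨c, rfl, hci⟩]
      exact ReflTransGen.refl
  refine ⟨m - (b - a), by omega, fun j => if j < a then y j else y (j + (b - a)),
    fun j => if j < a then x j else x (j + (b - a)), ?_, ?_, ?_⟩
  · intro i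
    by_cases ha : 0 < a
    · simpa [ha] using h0 i
    · obtain rfl : a = 0 := by omega
      have h6 : ReachLoc Eloc i (u i) (y b i) := ReflTransGen.trans (h0 i) (hL i)
      simpa using h6
  · have h1 : ¬ (m - (b - a) < a) := by omega
    have h2 : m - (b - a) + (b - a) = m := by omega
    simp only [h1, if_false, h2, hv]
  · intro j hjm
    by_cases h1 : j + 1 < a
    · have h2 : j < a := by omega
      simpa only [h1, h2, if_true] using hj j (by omega)
    · by_cases h2 : j < a
      · have h3 := hj j (by omega)
        have h4 : j + 1 = a := by omega
        have h5 : j + 1 + (b - a) = b := by omega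
        simp only [h1, h2, if_true, if_false, h5]
        rw [h4] at h3
        exact ⟨h3.1, fun i => ReflTransGen.trans (h3.2 i) (hL i)⟩
      · have h3 := hj (j + (b - a)) (by omega)
        have h5 : j + 1 + (b - a) = j + (b - a) + 1 := by omega
        simpa only [h1, h2, if_false, h5] using h3

end Aux

/-- bounded decomposition for a single synchronizing transition
`c ∈ C`: if `∼_c` restricted to `V_{{c}}` has exactly `k` (finitely many)
equivalence classes, then `Reach_{Σ^l ∪ {c}}(u,v)` holds iff the componentwise
decomposition of Statement 6 holds along the constant word `c, …, c` of some
length `m` with `0 ≤ m ≤ k`. -/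
theorem reach_decomposition_bounded
    {n : ℕ} (hn : 1 ≤ n)
    {V Locl Syncl : Fin n → Type*}
    [∀ i, Fintype (Locl i)] [∀ i, Fintype (Syncl i)]
    (Eloc : ∀ i, Locl i → V i → V i → Prop)
    (Esync : ∀ i, Syncl i → V i → V i → Prop)
    (C : Set (∀ i, Option (Syncl i)))
    (c : ∀ i, Option (Syncl i)) (hc : c ∈ C)
    (k : ℕ)
    (hfin : (Classes Esync ({c} : Set (∀ i, Option (Syncl i)))).Finite)
    (hcard : (Classes Esync ({c} : Set (∀ i, Option (Syncl i)))).ncard = k)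
    (u v : ∀ i, V i) :
    Relation.ReflTransGen (Step Eloc Esync ({c} : Set (∀ i, Option (Syncl i)))) u v ↔
      ∃ m : ℕ, m ≤ k ∧
        ∀ i, ∃ (y : Fin (m + 1) → V i) (x : Fin m → V i),
          ReachLoc Eloc i (u i) (y 0) ∧
          y (Fin.last m) = v i ∧
          ∀ j : Fin m,
            OptStep (Esync i) (c i) (y j.castSucc) (x j) ∧
            ReachLoc Eloc i (x j) (y j.succ) := by
  constructor
  · intro h
    classical
    have hex := aux_exists Eloc Esync c u v h
    have hspec := Nat.find_spec hex
    have hle : Nat.find hex ≤ k := by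
      by_contra hlt
      obtain ⟨m', hm', hp⟩ := aux_shorten Eloc Esync c u v hfin _ (by omega) hspec
      exact Nat.find_min hex hm' hp
    obtain ⟨y, x, h0, hv, hj⟩ := hspec
    refine ⟨Nat.find hex, hle, fun i => ⟨fun j => y j i, fun j => x j i, h0 i, ?_, ?_⟩⟩
    · exact congrFun hv i
    · intro j
      exact ⟨(hj j j.2).1 i, (hj j j.2).2 i⟩
  · rintro ⟨m, -, h⟩
    choose y x h0 hv hj using h
    have key : ∀ j : Fin (m + 1),
        ReflTransGen (Step Eloc Esync {c}) u (fun i => y i j) := by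
      intro j
      induction j using Fin.induction with
      | zero => exact aux_local Eloc Esync {c} _ _ h0
      | succ j ih =>
        refine (ih.tail (c := fun i => x i j) (Or.inr ⟨c, rfl, fun i => (hj i j).1⟩)).trans ?_
        exact aux_local Eloc Esync {c} _ _ fun i => (hj i j).2
    have := key (Fin.last m)
    rwa [show (fun i => y i (Fin.last m)) = v from funext hv] at this
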